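/- arXiv:2311.05719 — 2 statements merged into one kernel-verified Lean document; each statement's English description precedes it below -/
import Mathlib

section
/- Let G be a (clock, diamond)-free graph with no star cutset, and let a, u, v ∈ V(G) induce a seagull (edges au, av; u non-adjacent to v). If a is a claw center in G, then G contains an induced three-path configuration Q with a, u, v ∈ V(Q) such that a is a claw center in Q; moreover Q is a theta with end a or a pyramid with apex a. -/
open SimpleGraph

variable {V : Type*}

/-- A hole (induced cycle on at least 4 vertices) given as an embedding of the cycle `ZMod n`. -/
def IsHoleEmb (G : SimpleGraph V) (n : ℕ) (f : ZMod n → V) : Prop :=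
  4 ≤ n ∧ Function.Injective f ∧
    ∀ i j, G.Adj (f i) (f j) ↔ (i = j + 1 ∨ j = i + 1)

/-- `G` contains a clock: a hole `C` together with a vertex not in `C` having two
non-adjacent neighbours in `C`. -/
def ContainsClock (G : SimpleGraph V) : Prop :=
  ∃ (n : ℕ) (f : ZMod n → V) (v : V),
    IsHoleEmb G n f ∧ (∀ i, v ≠ f i) ∧
      ∃ i j, G.Adj v (f i) ∧ G.Adj v (f j) ∧ f i ≠ f j ∧ ¬ G.Adj (f i) (f j)

def ClockFree (G : SimpleGraph V) : Prop := ¬ ContainsClock G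

/-- `G` has no induced diamond (`K₄` minus an edge). -/
def DiamondFree (G : SimpleGraph V) : Prop :=
  ¬ ∃ a b c d : V, a ≠ b ∧ a ≠ c ∧ a ≠ d ∧ b ≠ c ∧ b ≠ d ∧ c ≠ d ∧
    G.Adj a b ∧ G.Adj a c ∧ G.Adj a d ∧ G.Adj b c ∧ G.Adj b d ∧ ¬ G.Adj c d

/-- `X` is a cutset of `G`: removing `X` leaves a non-empty disconnected graph. -/
def IsCutset (G : SimpleGraph V) (X : Set V) : Prop :=
  (Xᶜ : Set V).Nonempty ∧ ¬ (G.induce (Xᶜ : Set V)).Connected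

def HasStarCutset (G : SimpleGraph V) : Prop :=
  ∃ X : Set V, IsCutset G X ∧ ∃ x ∈ X, ∀ y ∈ X, y = x ∨ G.Adj x y

def HasCliqueCutset (G : SimpleGraph V) : Prop :=
  ∃ X : Set V, IsCutset G X ∧ G.IsClique X

/-- `X` separates `Y` from `Z`: every path with one end in `Y` and the other in `Z`
contains a vertex of `X`. -/
def Separates (G : SimpleGraph V) (X Y Z : Set V) : Prop :=
  ∀ y ∈ Y, ∀ z ∈ Z, ∀ p : G.Walk y z, p.IsPath → ∃ x ∈ X, x ∈ p.support

def IsClawCenter (G : SimpleGraph V) (v : V) : Prop :=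
  ∃ x y z, G.Adj v x ∧ G.Adj v y ∧ G.Adj v z ∧ x ≠ y ∧ x ≠ z ∧ y ≠ z ∧
    ¬ G.Adj x y ∧ ¬ G.Adj x z ∧ ¬ G.Adj y z

/-- An induced path on `n+1` vertices given as a function from `Fin (n+1)`. -/
def IsPathEmb (G : SimpleGraph V) (n : ℕ) (f : Fin (n+1) → V) : Prop :=
  Function.Injective f ∧
    ∀ i j, G.Adj (f i) (f j) ↔ ((i : ℕ) + 1 = (j : ℕ) ∨ (j : ℕ) + 1 = (i : ℕ))

/-- Cross conditions between two paths of a pyramid sharing only the apex (index 0):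
off-apex parts are disjoint and the only possible edge joins the two far ends. -/
def PyrNoCross (G : SimpleGraph V) {n m : ℕ} (f : Fin (n+1) → V) (g : Fin (m+1) → V) : Prop :=
  ∀ i j, i ≠ 0 → j ≠ 0 →
    f i ≠ g j ∧ (G.Adj (f i) (g j) → i = Fin.last n ∧ j = Fin.last m)

/-- Cross conditions between two paths of a theta: the interiors are disjoint and
anticomplete. -/
def ThetaNoCross (G : SimpleGraph V) {n m : ℕ} (f : Fin (n+1) → V) (g : Fin (m+1) → V) : Prop :=
  ∀ i j, i ≠ 0 → i ≠ Fin.last n → j ≠ 0 → j ≠ Fin.last m →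
    f i ≠ g j ∧ ¬ G.Adj (f i) (g j)

/-- Cross conditions between two paths of a prism: they are disjoint and the only
edges join the two first ends or the two last ends. -/
def PrismNoCross (G : SimpleGraph V) {n m : ℕ} (f : Fin (n+1) → V) (g : Fin (m+1) → V) : Prop :=
  ∀ i j, f i ≠ g j ∧
    (G.Adj (f i) (g j) → (i = 0 ∧ j = 0) ∨ (i = Fin.last n ∧ j = Fin.last m))

/-- A pyramid with apex `a`, given by three induced paths from `a` to a triangle. -/
def PyramidSpec (G : SimpleGraph V) (a : V) (n₁ n₂ n₃ : ℕ)
    (f₁ : Fin (n₁+1) → V) (f₂ : Fin (n₂+1) → V) (f₃ : Fin (n₃+1) → V) : Prop :=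
  IsPathEmb G n₁ f₁ ∧ IsPathEmb G n₂ f₂ ∧ IsPathEmb G n₃ f₃ ∧
  f₁ 0 = a ∧ f₂ 0 = a ∧ f₃ 0 = a ∧
  1 ≤ n₁ ∧ 1 ≤ n₂ ∧ 1 ≤ n₃ ∧
  G.Adj (f₁ (Fin.last n₁)) (f₂ (Fin.last n₂)) ∧
  G.Adj (f₂ (Fin.last n₂)) (f₃ (Fin.last n₃)) ∧
  G.Adj (f₁ (Fin.last n₁)) (f₃ (Fin.last n₃)) ∧
  ¬(n₁ = 1 ∧ n₂ = 1) ∧ ¬(n₁ = 1 ∧ n₃ = 1) ∧ ¬(n₂ = 1 ∧ n₃ = 1) ∧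
  PyrNoCross G f₁ f₂ ∧ PyrNoCross G f₁ f₃ ∧ PyrNoCross G f₂ f₃

def IsPyramidWithApex (G : SimpleGraph V) (Q : Set V) (a : V) : Prop :=
  ∃ (n₁ n₂ n₃ : ℕ) (f₁ : Fin (n₁+1) → V) (f₂ : Fin (n₂+1) → V) (f₃ : Fin (n₃+1) → V),
    PyramidSpec G a n₁ n₂ n₃ f₁ f₂ f₃ ∧
    Q = Set.range f₁ ∪ Set.range f₂ ∪ Set.range f₃

/-- A short pyramid: a pyramid one of whose paths has length exactly one. -/
def IsShortPyramidWithApex (G : SimpleGraph V) (Q : Set V) (a : V) : Prop :=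
  ∃ (n₁ n₂ n₃ : ℕ) (f₁ : Fin (n₁+1) → V) (f₂ : Fin (n₂+1) → V) (f₃ : Fin (n₃+1) → V),
    PyramidSpec G a n₁ n₂ n₃ f₁ f₂ f₃ ∧ (n₁ = 1 ∨ n₂ = 1 ∨ n₃ = 1) ∧
    Q = Set.range f₁ ∪ Set.range f₂ ∪ Set.range f₃

/-- A theta with ends `a, b`, given by three induced paths from `a` to `b` with
pairwise disjoint, pairwise anticomplete interiors. -/
def ThetaSpec (G : SimpleGraph V) (a b : V) (n₁ n₂ n₃ : ℕ)
    (f₁ : Fin (n₁+1) → V) (f₂ : Fin (n₂+1) → V) (f₃ : Fin (n₃+1) → V) : Prop :=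
  IsPathEmb G n₁ f₁ ∧ IsPathEmb G n₂ f₂ ∧ IsPathEmb G n₃ f₃ ∧
  f₁ 0 = a ∧ f₂ 0 = a ∧ f₃ 0 = a ∧
  f₁ (Fin.last n₁) = b ∧ f₂ (Fin.last n₂) = b ∧ f₃ (Fin.last n₃) = b ∧
  1 ≤ n₁ ∧ 1 ≤ n₂ ∧ 1 ≤ n₃ ∧ a ≠ b ∧ ¬ G.Adj a b ∧
  ThetaNoCross G f₁ f₂ ∧ ThetaNoCross G f₁ f₃ ∧ ThetaNoCross G f₂ f₃

def IsThetaWithEnds (G : SimpleGraph V) (Q : Set V) (a b : V) : Prop :=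
  ∃ (n₁ n₂ n₃ : ℕ) (f₁ : Fin (n₁+1) → V) (f₂ : Fin (n₂+1) → V) (f₃ : Fin (n₃+1) → V),
    ThetaSpec G a b n₁ n₂ n₃ f₁ f₂ f₃ ∧
    Q = Set.range f₁ ∪ Set.range f₂ ∪ Set.range f₃

/-- A prism: two disjoint triangles joined by three disjoint induced paths with
no other edges between them. -/
def IsPrismOn (G : SimpleGraph V) (Q : Set V) : Prop :=
  ∃ (n₁ n₂ n₃ : ℕ) (f₁ : Fin (n₁+1) → V) (f₂ : Fin (n₂+1) → V) (f₃ : Fin (n₃+1) → V),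
    IsPathEmb G n₁ f₁ ∧ IsPathEmb G n₂ f₂ ∧ IsPathEmb G n₃ f₃ ∧
    1 ≤ n₁ ∧ 1 ≤ n₂ ∧ 1 ≤ n₃ ∧
    G.Adj (f₁ 0) (f₂ 0) ∧ G.Adj (f₂ 0) (f₃ 0) ∧ G.Adj (f₁ 0) (f₃ 0) ∧
    G.Adj (f₁ (Fin.last n₁)) (f₂ (Fin.last n₂)) ∧
    G.Adj (f₂ (Fin.last n₂)) (f₃ (Fin.last n₃)) ∧
    G.Adj (f₁ (Fin.last n₁)) (f₃ (Fin.last n₃)) ∧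
    PrismNoCross G f₁ f₂ ∧ PrismNoCross G f₁ f₃ ∧ PrismNoCross G f₂ f₃ ∧
    Q = Set.range f₁ ∪ Set.range f₂ ∪ Set.range f₃

/-- A three-path configuration: a theta, a prism, or a pyramid. -/
def IsThreePathConfig (G : SimpleGraph V) (Q : Set V) : Prop :=
  (∃ a b, IsThetaWithEnds G Q a b) ∨ IsPrismOn G Q ∨ (∃ a, IsPyramidWithApex G Q a)

/-- `D` is a connected component of the induced subgraph `G[S]`. -/
def IsComponentOf (G : SimpleGraph V) (S D : Set V) : Prop :=
  D.Nonempty ∧ D ⊆ S ∧ (G.induce D).Connected ∧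
    ∀ u ∈ D, ∀ v ∈ S, v ∉ D → ¬ G.Adj u v

/-- The weight of a set of vertices. -/
noncomputable def wSum [Fintype V] (w : V → ℝ) (S : Set V) : ℝ :=
  ∑ v, S.indicator w v

/-- A weight function: values in `[0,1]` summing to `1`. -/
def IsWeightFun [Fintype V] (w : V → ℝ) : Prop :=
  (∀ v, 0 ≤ w v ∧ w v ≤ 1) ∧ ∑ v, w v = 1

/-- `X` is a `(w,c)`-balanced separator: every component of `G \ X` has weight at most `c`. -/
def IsBalancedSep [Fintype V] (G : SimpleGraph V) (w : V → ℝ) (c : ℝ) (X : Set V) : Prop :=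
  ∀ D : Set V, IsComponentOf G (Xᶜ) D → wSum w D ≤ c

/-- `X` is a `(w,G)`-shield for `X'`, phrased via the heavy components `B`, `B'`
of the canonical separations. -/
def IsShield [Fintype V] (G : SimpleGraph V) (w : V → ℝ) (X X' : Set V) : Prop :=
  ∃ B B' : Set V,
    IsComponentOf G (Xᶜ) B ∧ 1/2 < wSum w B ∧
    IsComponentOf G (X'ᶜ) B' ∧ 1/2 < wSum w B' ∧
    ((B ∪ X ⊂ B' ∪ X') ∨ (B ∪ X = B' ∪ X' ∧ B' ⊂ B))

/-- The central bag `β(G,w,𝒳)`: the intersection of the sets `B ∪ C` over canonical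
separations `(A,C,B)` of members of `𝒳`. -/
def CentralBag [Fintype V] (G : SimpleGraph V) (w : V → ℝ) (𝓧 : Set (Set V)) : Set V :=
  {v | ∀ X ∈ 𝓧, ∀ B : Set V, IsComponentOf G (Xᶜ) B → 1/2 < wSum w B → v ∈ B ∪ X}

/-- Two separations `(A,C,B)` and `(A',C',B')` are loosely non-crossing: no path has
one end in `A ∩ C'`, the other in `A' ∩ C`, and interior in `A ∩ A'`. -/
def LooselyNonCrossing (G : SimpleGraph V) (A C A' C' : Set V) : Prop :=
  ¬ ∃ (u v : V) (p : G.Walk u v), p.IsPath ∧ u ∈ A ∩ C' ∧ v ∈ A' ∩ C ∧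
    ∀ x ∈ p.support, x ≠ u → x ≠ v → x ∈ A ∩ A'

/-- `G` has a tree decomposition of width at most `r`. -/
def HasTreeDecompOfWidthLE (G : SimpleGraph V) (r : ℝ) : Prop :=
  ∃ (ι : Type) (T : SimpleGraph ι) (τ : ι → Set V),
    T.IsTree ∧
    (∀ v : V, ∃ t, v ∈ τ t) ∧
    (∀ u v : V, G.Adj u v → ∃ t, u ∈ τ t ∧ v ∈ τ t) ∧
    (∀ v : V, (T.induce {t | v ∈ τ t}).Connected) ∧
    (∀ t, ((τ t).ncard : ℝ) - 1 ≤ r)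

namespace Seagull

/-- The first `n+1` values of `p` form an induced path. -/
def IP (G : SimpleGraph V) (n : ℕ) (p : ℕ → V) : Prop :=
  (∀ i j, i ≤ n → j ≤ n → p i = p j → i = j) ∧
  (∀ i j, i ≤ n → j ≤ n → (G.Adj (p i) (p j) ↔ (i + 1 = j ∨ j + 1 = i)))

/-- The first `n+1` values of `p` form a walk in `S` starting in `x`. -/
def Chain (G : SimpleGraph V) (S : Set V) (x : V) (n : ℕ) (p : ℕ → V) : Prop :=
  p 0 = x ∧ (∀ i, i ≤ n → p i ∈ S) ∧ ∀ i, i < n → G.Adj (p i) (p (i+1))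

lemma exists_chain {G : SimpleGraph V} {S : Set V} (h : (G.induce S).Connected) {x y : V}
    (hx : x ∈ S) (hy : y ∈ S) : ∃ n p, Chain G S x n p ∧ p n = y := by
  obtain ⟨w⟩ := h.preconnected ⟨x, hx⟩ ⟨y, hy⟩
  refine ⟨w.length, fun i => (w.getVert i).val, ⟨by simp, fun i _ => (w.getVert i).2, ?_⟩, by simp⟩
  intro i hi
  exact w.adj_getVert_succ hi

lemma exists_min {G : SimpleGraph V} {S : Set V} {x : V} (T : V → Prop)
    (h : ∃ n p, Chain G S x n p ∧ T (p n)) :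
    ∃ n p, Chain G S x n p ∧ T (p n) ∧ IP G n p ∧ ∀ i, i < n → ¬ T (p i) := by
  classical
  have hmin := fun m => Nat.find_min h (m := m)
  obtain ⟨p, hp, hT⟩ := Nat.find_spec h
  generalize Nat.find h = n at *
  obtain ⟨h0, hS, hA⟩ := hp
  -- no shortcuts
  have key : ∀ i j, i < j → j ≤ n → p i ≠ p j := by
    intro i j hij hj he
    refine hmin (n - (j - i)) (by omega) ⟨fun k => if k ≤ i then p k else p (k + (j - i)),
      ⟨by simp [h0], ?_, ?_⟩, ?_⟩
    · intro k hk
      dsimp only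
      split_ifs
      · exact hS _ (by omega)
      · exact hS _ (by omega)
    · intro k hk
      dsimp only
      split_ifs with h1 h2
      · exact hA _ (by omega)
      · have : k = i := by omega
        subst this
        rw [he, show k + 1 + (j - k) = j + 1 by omega]
        exact hA _ (by omega)
      · omega
      · rw [show k + 1 + (j - i) = k + (j - i) + 1 by omega]
        exact hA _ (by omega)
    · dsimp only
      split_ifs with h1
      · have h2 : n - (j - i) = i := by omega
        have h3 : j = n := by omega
        rw [h2, he, h3]; exact hT
      · rw [show n - (j - i) + (j - i) = n by omega]; exact hT
  have key2 : ∀ i j, i + 1 < j → j ≤ n → ¬ G.Adj (p i) (p j) := by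
    intro i j hij hj he
    refine hmin (n - (j - i - 1)) (by omega) ⟨fun k => if k ≤ i then p k else p (k + (j - i - 1)),
      ⟨by simp [h0], ?_, ?_⟩, ?_⟩
    · intro k hk
      dsimp only
      split_ifs
      · exact hS _ (by omega)
      · exact hS _ (by omega)
    · intro k hk
      dsimp only
      split_ifs with h1 h2
      · exact hA _ (by omega)
      · have : k = i := by omega
        subst this
        rw [show k + 1 + (j - k - 1) = j by omega]
        exact he
      · omega
      · rw [show k + 1 + (j - i - 1) = k + (j - i - 1) + 1 by omega]
        exact hA _ (by omega)
    · dsimp only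
      split_ifs with h1
      · omega
      · rw [show n - (j - i - 1) + (j - i - 1) = n by omega]; exact hT
  refine ⟨n, p, ⟨h0, hS, hA⟩, hT, ⟨?_, ?_⟩, ?_⟩
  · intro i j hi hj he
    rcases lt_trichotomy i j with h | h | h
    · exact absurd he (key i j h hj)
    · exact h
    · exact absurd he.symm (key j i h hi)
  · intro i j hi hj
    constructor
    · intro he
      by_contra hc
      rcases lt_trichotomy i j with h | h | h
      · exact key2 i j (by omega) hj he
      · subst h; exact G.irrefl he
      · exact key2 j i (by omega) hi he.symm
    · rintro (h | h)
      · subst h; exact hA _ (by omega)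
      · subst h; exact (hA _ (by omega)).symm
  · intro i hi hTi
    exact hmin i hi ⟨p, ⟨h0, fun k hk => hS k (by omega), fun k hk => hA k (by omega)⟩, hTi⟩

lemma IP.rev {G : SimpleGraph V} {n : ℕ} {p : ℕ → V} (h : IP G n p) :
    IP G n (fun i => p (n - i)) := by
  refine ⟨fun i j hi hj he => ?_, fun i j hi hj => ?_⟩
  · have := h.1 _ _ (by omega) (by omega) he
    omega
  · have := h.2 (n - i) (n - j) (by omega) (by omega)
    dsimp only
    rw [this]
    omega

lemma IP.shift {G : SimpleGraph V} {n : ℕ} {p : ℕ → V} (h : IP G n p) (t l : ℕ) (ht : t + l ≤ n) :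
    IP G l (fun i => p (t + i)) := by
  refine ⟨fun i j hi hj he => ?_, fun i j hi hj => ?_⟩
  · have := h.1 _ _ (by omega) (by omega) he
    omega
  · have := h.2 (t + i) (t + j) (by omega) (by omega)
    dsimp only
    rw [this]
    omega

lemma IP.take {G : SimpleGraph V} {n : ℕ} {p : ℕ → V} (h : IP G n p) (l : ℕ) (ht : l ≤ n) :
    IP G l p :=
  ⟨fun i j hi hj he => h.1 _ _ (by omega) (by omega) he,
    fun i j hi hj => h.2 i j (by omega) (by omega)⟩

lemma IP.const (G : SimpleGraph V) (x : V) : IP G 0 (fun _ => x) := by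
  refine ⟨fun i j hi hj _ => by omega, fun i j hi hj => ?_⟩
  have : ¬ G.Adj x x := G.irrefl
  simp only [this, false_iff]; omega

/-- Concatenation. -/
def app (k : ℕ) (r s : ℕ → V) : ℕ → V := fun i => if i ≤ k then r i else s (i - (k + 1))

lemma IP.append {G : SimpleGraph V} {k l : ℕ} {r s : ℕ → V} (hr : IP G k r) (hs : IP G l s)
    (hd : ∀ i j, i ≤ k → j ≤ l → r i ≠ s j)
    (ha : ∀ i j, i ≤ k → j ≤ l → (G.Adj (r i) (s j) ↔ (i = k ∧ j = 0))) :
    IP G (k + l + 1) (app k r s) := by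
  refine ⟨fun i j hi hj he => ?_, fun i j hi hj => ?_⟩
  · unfold app at he
    split_ifs at he with h1 h2 h2
    · exact hr.1 _ _ h1 h2 he
    · exact absurd he (hd _ _ h1 (by omega))
    · exact absurd he.symm (hd _ _ h2 (by omega))
    · have := hs.1 _ _ (by omega) (by omega) he
      omega
  · unfold app
    split_ifs with h1 h2 h2
    · exact hr.2 _ _ h1 h2
    · rw [ha _ _ h1 (by omega)]; omega
    · rw [G.adj_comm, ha _ _ h2 (by omega)]; omega
    · rw [hs.2 _ _ (by omega) (by omega)]; omega

lemma IP.toEmb {G : SimpleGraph V} {n : ℕ} {p : ℕ → V} (h : IP G n p) :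
    IsPathEmb G n (fun i : Fin (n+1) => p i.val) := by
  refine ⟨fun i j he => ?_, fun i j => h.2 _ _ (by omega) (by omega)⟩
  exact Fin.ext (h.1 _ _ (by omega) (by omega) he)

/-- Closing an induced path with one vertex gives a hole, so no clock. -/
lemma no_clock {G : SimpleGraph V} (hc : ClockFree G) {n : ℕ} {q : ℕ → V} (hq : IP G n q)
    (hn : 2 ≤ n) {a : V} (ha : ∀ i, i ≤ n → q i ≠ a)
    (hadj : ∀ i, i ≤ n → (G.Adj a (q i) ↔ (i = 0 ∨ i = n))) {z : V} (hz : ∀ i, i ≤ n → z ≠ q i)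
    (hza : z ≠ a) :
    (∀ i, 0 < i → i < n → G.Adj z a → ¬ G.Adj z (q i)) ∧
    (∀ i j, i ≤ n → j ≤ n → G.Adj z (q i) → G.Adj z (q j) → i ≠ j → ¬ G.Adj (q i) (q j) → False) := by
  have hlt : ∀ i : ZMod (n + 2), i.val < n + 2 := fun i => ZMod.val_lt i
  have hext : ∀ i j : ZMod (n + 2), i = j ↔ i.val = j.val :=
    fun i j => ⟨fun h => by rw [h], fun h => ZMod.val_injective _ h⟩
  have hsucc : ∀ i : ZMod (n + 2), (i + 1).val = if i.val = n + 1 then 0 else i.val + 1 := by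
    intro i
    have h1 : (1 : ZMod (n + 2)).val = 1 := ZMod.val_one'' (by omega)
    rw [ZMod.val_add, h1]
    have := hlt i
    split_ifs with h
    · rw [h]; exact Nat.mod_self _
    · exact Nat.mod_eq_of_lt (by omega)
  have hole : IsHoleEmb G (n + 2) (fun i : ZMod (n + 2) => if i.val ≤ n then q i.val else a) := by
    refine ⟨by omega, fun i j he => ?_, fun i j => ?_⟩
    · rw [hext]
      have h1 := hlt i
      have h2 := hlt j
      dsimp only at he
      split_ifs at he with h3 h4 h4
      · exact hq.1 _ _ h3 h4 he
      · exact absurd he (ha _ h3)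
      · exact absurd he.symm (ha _ h4)
      · omega
    · rw [hext, hext, hsucc, hsucc]
      have h1 := hlt i
      have h2 := hlt j
      dsimp only
      split_ifs with h3 h4 h4
      all_goals first
        | (rw [hq.2 _ _ (by omega) (by omega)]; omega)
        | (rw [hadj _ (by omega)]; omega)
        | (rw [G.adj_comm, hadj _ (by omega)]; omega)
        | (simp only [SimpleGraph.irrefl, false_iff]; omega)
  have hval : ∀ i, i ≤ n + 1 → ((i : ℕ) : ZMod (n + 2)).val = i :=
    fun i hi => ZMod.val_cast_of_lt (by omega)
  have hnot : ∀ i : ZMod (n + 2), z ≠ if i.val ≤ n then q i.val else a := by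
    intro i
    split_ifs with h
    · exact hz _ h
    · exact hza
  refine ⟨?_, ?_⟩
  · intro i hi hin h1 h2
    refine hc ⟨n + 2, _, z, hole, hnot, ((i : ℕ) : ZMod (n+2)), ((n + 1 : ℕ) : ZMod (n+2)), ?_⟩
    simp only [hval i (by omega), hval (n + 1) le_rfl]
    rw [if_pos (by omega), if_neg (by omega)]
    refine ⟨h2, h1, ha _ (by omega), ?_⟩
    rw [G.adj_comm, hadj _ (by omega)]; omega
  · intro i j hi hj h1 h2 hij h3
    refine hc ⟨n + 2, _, z, hole, hnot, ((i : ℕ) : ZMod (n+2)), ((j : ℕ) : ZMod (n+2)), ?_⟩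
    simp only [hval i (by omega), hval j (by omega)]
    rw [if_pos (by omega), if_pos (by omega)]
    exact ⟨h1, h2, fun h => hij (hq.1 _ _ hi hj h), h3⟩

/-- The configuration: `a`, a path `p` of length `m+1` between two neighbours of `a` and a path `r`
of length `k` from a third neighbour to a vertex with a neighbour inside `p`. -/
structure Conf (G : SimpleGraph V) (a : V) (m k : ℕ) (p r : ℕ → V) : Prop where
  m1 : 1 ≤ m
  ipp : IP G (m + 1) p
  ipr : IP G k r
  pa : ∀ i, i ≤ m + 1 → p i ≠ a
  ra : ∀ i, i ≤ k → r i ≠ a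
  padj : ∀ i, i ≤ m + 1 → (G.Adj a (p i) ↔ (i = 0 ∨ i = m + 1))
  radj : ∀ i, i ≤ k → (G.Adj a (r i) ↔ i = 0)
  disj : ∀ i j, i ≤ k → j ≤ m + 1 → r i ≠ p j
  r0 : ∀ j, j = 0 ∨ j = m + 1 → ¬ G.Adj (r 0) (p j)
  far : ∀ i j, i < k → 1 ≤ j → j ≤ m → ¬ G.Adj (r i) (p j)
  near : ∃ j, 1 ≤ j ∧ j ≤ m ∧ G.Adj (r k) (p j)

lemma Conf.rev {G : SimpleGraph V} {a : V} {m k : ℕ} {p r : ℕ → V} (h : Conf G a m k p r) :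
    Conf G a m k (fun i => p (m + 1 - i)) r where
  m1 := h.m1
  ipp := h.ipp.rev
  ipr := h.ipr
  pa i hi := h.pa _ (by omega)
  ra := h.ra
  padj i hi := by
    rw [h.padj _ (by omega)]; omega
  radj := h.radj
  disj i j hi hj := h.disj _ _ hi (by omega)
  r0 j hj := h.r0 _ (by omega)
  far i j hi hj hm := h.far i _ hi (by omega) (by omega)
  near := by
    obtain ⟨j, h1, h2, h3⟩ := h.near
    refine ⟨m + 1 - j, by omega, by omega, ?_⟩
    rw [show m + 1 - (m + 1 - j) = j by omega]; exact h3

/-- If the end `v = p (m+1)` is adjacent to `r j` with `j` minimal, `u = p 0` has no neighbour in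
`r 0 .. r j`. -/
lemma Conf.first {G : SimpleGraph V} (hc : ClockFree G) {a : V} {m k : ℕ} {p r : ℕ → V}
    (h : Conf G a m k p r) (j : ℕ) (hj : j ≤ k) (hadj : G.Adj (r j) (p (m + 1)))
    (hmin : ∀ i, i < j → ¬ G.Adj (r i) (p (m + 1))) : ∀ i, i ≤ j → ¬ G.Adj (r i) (p 0) := by
  intro i hi hA
  have hi0 : i ≠ 0 := fun e => h.r0 0 (Or.inl rfl) (e ▸ hA)
  have hip : IP G (j + 0 + 1) (app j r (fun _ => p (m + 1))) := by
    refine (h.ipr.take j hj).append (IP.const G _) (fun i' j' h1 h2 => h.disj _ _ (by omega) le_rfl) ?_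
    intro i' j' h1 h2
    constructor
    · intro h3
      refine ⟨?_, by omega⟩
      by_contra h4
      exact hmin i' (by omega) h3
    · rintro ⟨rfl, rfl⟩; exact hadj
  refine (no_clock hc hip (by omega) (a := a) ?_ ?_ (z := p 0) ?_ (h.pa 0 (by omega))).1 i (by omega)
    (by omega) ?_ ?_
  · intro i' h1
    unfold app
    split_ifs with h2
    · exact h.ra _ (by omega)
    · exact h.pa _ le_rfl
  · intro i' h1
    unfold app
    split_ifs with h2
    · rw [h.radj _ (by omega)]; omega
    · rw [h.padj _ le_rfl]; omega
  · intro i' h1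
    unfold app
    split_ifs with h2
    · exact (h.disj _ _ (by omega) (by omega)).symm
    · intro h3
      have := h.ipp.1 _ _ (by omega) (by omega) h3
      omega
  · exact ((h.padj 0 (by omega)).2 (Or.inl rfl)).symm
  · unfold app
    rw [if_pos hi]; exact hA.symm

/-- If `v` has no neighbour in `r`, neither has `u`. -/
lemma Conf.second {G : SimpleGraph V} (hc : ClockFree G) {a : V} {m k : ℕ} {p r : ℕ → V}
    (h : Conf G a m k p r) (hv : ∀ i, i ≤ k → ¬ G.Adj (r i) (p (m + 1))) :
    ∀ i, i ≤ k → ¬ G.Adj (r i) (p 0) := by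
  classical
  intro i hi hA
  have hi0 : i ≠ 0 := fun e => h.r0 0 (Or.inl rfl) (e ▸ hA)
  obtain ⟨t, ht1, htm, htA, htmax⟩ : ∃ t, 1 ≤ t ∧ t ≤ m ∧ G.Adj (r k) (p t) ∧
      ∀ j, t < j → j ≤ m → ¬ G.Adj (r k) (p j) := by
    obtain ⟨j, h1, h2, h3⟩ := h.near
    have hP : 1 ≤ j ∧ G.Adj (r k) (p j) := ⟨h1, h3⟩
    have hs := Nat.findGreatest_spec (P := fun j => 1 ≤ j ∧ G.Adj (r k) (p j)) h2 hP
    refine ⟨_, hs.1, Nat.findGreatest_le m, hs.2, fun j' h4 h5 h6 => ?_⟩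
    exact Nat.findGreatest_is_greatest h4 h5 ⟨by omega, h6⟩
  have hip : IP G (k + (m + 1 - t) + 1) (app k r (fun i => p (t + i))) := by
    refine h.ipr.append (h.ipp.shift t _ (by omega)) (fun i' j' h1 h2 => h.disj _ _ (by omega) (by omega)) ?_
    intro i' j' h1 h2
    constructor
    · intro h3
      by_cases h4 : t + j' = m + 1
      · rw [h4] at h3
        exact absurd h3 (hv _ h1)
      have h5 : i' = k := by
        by_contra h5
        exact h.far i' (t + j') (by omega) (by omega) (by omega) h3
      subst h5
      refine ⟨rfl, ?_⟩
      by_contra h6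
      exact htmax (t + j') (by omega) (by omega) h3
    · rintro ⟨rfl, rfl⟩; exact htA
  refine (no_clock hc hip (by omega) (a := a) ?_ ?_ (z := p 0) ?_ (h.pa 0 (by omega))).1 i (by omega)
    (by omega) ?_ ?_
  · intro i' h1
    unfold app
    split_ifs with h2
    · exact h.ra _ (by omega)
    · exact h.pa _ (by omega)
  · intro i' h1
    unfold app
    split_ifs with h2
    · rw [h.radj _ (by omega)]; omega
    · rw [h.padj _ (by omega)]; omega
  · intro i' h1
    unfold app
    split_ifs with h2
    · exact (h.disj _ _ (by omega) (by omega)).symm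
    · intro h3
      have := h.ipp.1 _ _ (by omega) (by omega) h3
      omega
  · exact ((h.padj 0 (by omega)).2 (Or.inl rfl)).symm
  · unfold app
    rw [if_pos hi]; exact hA.symm

lemma Conf.ends {G : SimpleGraph V} (hc : ClockFree G) {a : V} {m k : ℕ} {p r : ℕ → V}
    (h : Conf G a m k p r) :
    (∀ i, i ≤ k → ¬ G.Adj (r i) (p 0)) ∧ (∀ i, i ≤ k → ¬ G.Adj (r i) (p (m + 1))) := by
  classical
  have hsym : (∀ i, i ≤ k → ¬ G.Adj (r i) (p 0)) → (∀ i, i ≤ k → ¬ G.Adj (r i) (p (m + 1))) := by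
    intro hu
    have := h.rev.second hc (by simpa using hu)
    simpa using this
  by_cases hv : ∀ i, i ≤ k → ¬ G.Adj (r i) (p (m + 1))
  · exact ⟨h.second hc hv, hv⟩
  by_cases hu : ∀ i, i ≤ k → ¬ G.Adj (r i) (p 0)
  · exact ⟨hu, hsym hu⟩
  exfalso
  push Not at hu hv
  have hu1 := Nat.find_spec hu
  have hv1 := Nat.find_spec hv
  have hu2 := fun i => Nat.find_min hu (m := i)
  have hv2 := fun i => Nat.find_min hv (m := i)
  generalize Nat.find hu = i at *
  generalize Nat.find hv = j at *
  rcases le_total i j with hij | hij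
  · exact h.first hc j hv1.1 hv1.2 (fun i' h1 h2 => hv2 i' h1 ⟨by omega, h2⟩) i hij hu1.2
  · have := h.rev.first hc i hu1.1 (by simpa using hu1.2)
      (fun i' h1 h2 => hu2 i' h1 ⟨by omega, by simpa using h2⟩) j hij
    exact this (by simpa using hv1.2)

/-- Prepend a vertex. -/
lemma IP.cons {G : SimpleGraph V} {l : ℕ} {s : ℕ → V} (hs : IP G l s) {a : V}
    (hd : ∀ j, j ≤ l → s j ≠ a) (ha : ∀ j, j ≤ l → (G.Adj a (s j) ↔ j = 0)) :
    IP G (l + 1) (app 0 (fun _ => a) s) := by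
  have := (IP.const G a).append hs (fun i j _ hj => (hd j hj).symm)
    (fun i j hi hj => by rw [ha j hj]; omega)
  rwa [show 0 + l + 1 = l + 1 by omega] at this

lemma cons_zero {a : V} {s : ℕ → V} : app 0 (fun _ => a) s 0 = a := by simp [app]
lemma cons_succ {a : V} {s : ℕ → V} (i : ℕ) : app 0 (fun _ => a) s (i + 1) = s i := by simp [app]

lemma cons_pos {a : V} {s : ℕ → V} {i : ℕ} (h : i ≠ 0) : app 0 (fun _ => a) s i = s (i - 1) := by
  obtain ⟨j, rfl⟩ := Nat.exists_eq_succ_of_ne_zero h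
  simp [app]

lemma mem_cons {a : V} {s : ℕ → V} {l : ℕ} (j : ℕ) (hj : j ≤ l) :
    s j ∈ Set.range (fun i : Fin (l + 1 + 1) => app 0 (fun _ => a) s i.val) :=
  ⟨⟨j + 1, by omega⟩, cons_succ j⟩

lemma Conf.final {G : SimpleGraph V} (hc : ClockFree G) {a : V} {m k : ℕ} {p r : ℕ → V}
    (h : Conf G a m k p r) : ∃ Q : Set V,
      ((∃ b, IsThetaWithEnds G Q a b) ∨ IsPyramidWithApex G Q a) ∧
      a ∈ Q ∧ p 0 ∈ Q ∧ p (m + 1) ∈ Q ∧ r 0 ∈ Q := by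
  classical
  obtain ⟨hu, hv⟩ := h.ends hc
  obtain ⟨t, ht1, htm, htA, htmin⟩ : ∃ t, 1 ≤ t ∧ t ≤ m ∧ G.Adj (r k) (p t) ∧
      ∀ j, 1 ≤ j → j < t → ¬ G.Adj (r k) (p j) := by
    have h1 := Nat.find_spec h.near
    have h2 := fun i => Nat.find_min h.near (m := i)
    exact ⟨_, h1.1, h1.2.1, h1.2.2, fun j h3 h4 h5 => h2 j h4 ⟨h3, by omega, h5⟩⟩
  have hfar : ∀ j, t + 1 < j → j ≤ m → ¬ G.Adj (r k) (p j) := by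
    intro j h1 h2 h3
    refine (no_clock hc h.ipp (by have := h.m1; omega) h.pa h.padj (z := r k)
      (fun i hi => h.disj _ _ le_rfl hi) (h.ra _ le_rfl)).2 t j (by omega) (by omega) htA h3
      (by omega) ?_
    rw [h.ipp.2 _ _ (by omega) (by omega)]; omega
  have hcross : ∀ i j, i ≤ k → j ≤ m + 1 → G.Adj (r i) (p j) → i = k ∧ (j = t ∨ (j = t + 1 ∧ t < m)) := by
    intro i j hi hj hA
    have h1 : j ≠ 0 := fun e => hu i hi (e ▸ hA)
    have h2 : j ≠ m + 1 := fun e => hv i hi (e ▸ hA)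
    have h3 : i = k := by
      by_contra h3
      exact h.far i j (by omega) (by omega) (by omega) hA
    subst h3
    refine ⟨rfl, ?_⟩
    by_contra h4
    rcases lt_or_ge j t with h5 | h5
    · exact htmin j (by omega) h5 hA
    · exact hfar j (by omega) (by omega) hA
  have P1 : IP G (t + 1) (app 0 (fun _ => a) p) := by
    refine (h.ipp.take t (by omega)).cons (fun j hj => h.pa _ (by omega)) (fun j hj => ?_)
    rw [h.padj _ (by omega)]; omega
  have P2 : ∀ l, l ≤ m → IP G (l + 1) (app 0 (fun _ => a) (fun i => p (m + 1 - i))) := by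
    intro l hl
    refine (h.ipp.rev.take l (by omega)).cons (fun j hj => h.pa _ (by omega)) (fun j hj => ?_)
    rw [h.padj _ (by omega)]; omega
  by_cases hcase : t < m ∧ G.Adj (r k) (p (t + 1))
  · obtain ⟨htm', hA'⟩ := hcase
    have P3 : IP G (k + 1) (app 0 (fun _ => a) r) := h.ipr.cons h.ra h.radj
    refine ⟨_, Or.inr ⟨t + 1, (m - t) + 1, k + 1, _, _, _, ⟨P1.toEmb, (P2 (m - t) (by omega)).toEmb,
      P3.toEmb, cons_zero, cons_zero, cons_zero, by omega, by omega, by omega, ?_, ?_, ?_, by omega,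
      by omega, by omega, ?_, ?_, ?_⟩, rfl⟩, ?_⟩
    · simp only [Fin.val_last, cons_succ]
      rw [h.ipp.2 _ _ (by omega) (by omega)]; omega
    · simp only [Fin.val_last, cons_succ]
      rw [show m + 1 - (m - t) = t + 1 by omega]; exact hA'.symm
    · simp only [Fin.val_last, cons_succ]
      exact htA.symm
    · intro i j hi hj
      have hi' : i.val ≠ 0 := fun e => hi (Fin.ext e)
      have hj' : j.val ≠ 0 := fun e => hj (Fin.ext e)
      have hi2 := i.2
      have hj2 := j.2
      simp only [cons_pos hi', cons_pos hj', Fin.ext_iff, Fin.val_last]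
      rw [h.ipp.2 _ _ (by omega) (by omega)]
      refine ⟨fun e => ?_, by omega⟩
      have := h.ipp.1 _ _ (by omega) (by omega) e
      omega
    · intro i j hi hj
      have hi' : i.val ≠ 0 := fun e => hi (Fin.ext e)
      have hj' : j.val ≠ 0 := fun e => hj (Fin.ext e)
      have hi2 := i.2
      have hj2 := j.2
      simp only [cons_pos hi', cons_pos hj', Fin.ext_iff, Fin.val_last]
      refine ⟨(h.disj _ _ (by omega) (by omega)).symm, fun e => ?_⟩
      have := hcross _ _ (by omega) (by omega) e.symm
      omega
    · intro i j hi hj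
      have hi' : i.val ≠ 0 := fun e => hi (Fin.ext e)
      have hj' : j.val ≠ 0 := fun e => hj (Fin.ext e)
      have hi2 := i.2
      have hj2 := j.2
      simp only [cons_pos hi', cons_pos hj', Fin.ext_iff, Fin.val_last]
      refine ⟨(h.disj _ _ (by omega) (by omega)).symm, fun e => ?_⟩
      have := hcross _ _ (by omega) (by omega) e.symm
      omega
    · exact ⟨Or.inl (Or.inl ⟨0, cons_zero⟩), Or.inl (Or.inl (mem_cons 0 (by omega))),
        Or.inl (Or.inr (mem_cons (s := fun i => p (m + 1 - i)) 0 (by omega))),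
        Or.inr (mem_cons 0 (by omega))⟩
  · have hcr : ∀ i j, i ≤ k → j ≤ m + 1 → (G.Adj (r i) (p j) ↔ (i = k ∧ j = t)) := by
      intro i j hi hj
      refine ⟨fun e => ?_, ?_⟩
      · obtain ⟨h1, h2 | ⟨h2, h3⟩⟩ := hcross i j hi hj e
        · exact ⟨h1, h2⟩
        · subst h1 h2
          exact absurd ⟨h3, e⟩ hcase
      · rintro ⟨rfl, rfl⟩; exact htA
    have P3' : IP G (k + 0 + 1) (app k r (fun _ => p t)) :=
      h.ipr.append (IP.const G _) (fun i j hi hj => h.disj _ _ hi (by omega))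
        (fun i j hi hj => by rw [hcr _ _ hi (by omega)]; omega)
    have P3 : IP G (k + 1 + 1) (app 0 (fun _ => a) (app k r (fun _ => p t))) := by
      refine IP.cons P3' (fun j hj => ?_) (fun j hj => ?_)
      · unfold app
        split_ifs with h1
        · exact h.ra _ h1
        · exact h.pa _ (by omega)
      · unfold app
        split_ifs with h1
        · exact h.radj _ h1
        · rw [h.padj _ (by omega)]; omega
    have hr3 : ∀ i, i ≤ k → app k r (fun _ => p t) i = r i := fun i hi => if_pos hi
    refine ⟨_, Or.inl ⟨p t, t + 1, (m + 1 - t) + 1, k + 1 + 1, _, _, _, ⟨P1.toEmb,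
      (P2 (m + 1 - t) (by omega)).toEmb,
      P3.toEmb, cons_zero, cons_zero, cons_zero, ?_, ?_, ?_, by omega, by omega, by omega,
      (h.pa _ (by omega)).symm, ?_, ?_, ?_, ?_⟩, rfl⟩, ?_⟩
    · simp only [Fin.val_last, cons_succ]
    · simp only [Fin.val_last, cons_succ]
      rw [show m + 1 - (m + 1 - t) = t by omega]
    · simp only [Fin.val_last, cons_succ]
      exact if_neg (by omega)
    · rw [h.padj _ (by omega)]; omega
    · intro i j hi hi3 hj hj3
      have hi' : i.val ≠ 0 := fun e => hi (Fin.ext e)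
      have hj' : j.val ≠ 0 := fun e => hj (Fin.ext e)
      have hi2 := i.2
      have hj2 := j.2
      simp only [ne_eq, Fin.ext_iff, Fin.val_last] at hi3 hj3
      simp only [cons_pos hi', cons_pos hj']
      rw [h.ipp.2 _ _ (by omega) (by omega)]
      refine ⟨fun e => ?_, by omega⟩
      have := h.ipp.1 _ _ (by omega) (by omega) e
      omega
    · intro i j hi hi3 hj hj3
      have hi' : i.val ≠ 0 := fun e => hi (Fin.ext e)
      have hj' : j.val ≠ 0 := fun e => hj (Fin.ext e)
      have hi2 := i.2
      have hj2 := j.2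
      simp only [ne_eq, Fin.ext_iff, Fin.val_last] at hi3 hj3
      simp only [cons_pos hi', cons_pos hj']
      rw [hr3 _ (by omega), G.adj_comm, hcr _ _ (by omega) (by omega)]
      exact ⟨(h.disj _ _ (by omega) (by omega)).symm, by omega⟩
    · intro i j hi hi3 hj hj3
      have hi' : i.val ≠ 0 := fun e => hi (Fin.ext e)
      have hj' : j.val ≠ 0 := fun e => hj (Fin.ext e)
      have hi2 := i.2
      have hj2 := j.2
      simp only [ne_eq, Fin.ext_iff, Fin.val_last] at hi3 hj3
      simp only [cons_pos hi', cons_pos hj']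
      rw [hr3 _ (by omega), G.adj_comm, hcr _ _ (by omega) (by omega)]
      exact ⟨(h.disj _ _ (by omega) (by omega)).symm, by omega⟩
    · refine ⟨Or.inl (Or.inl ⟨0, cons_zero⟩), Or.inl (Or.inl (mem_cons 0 (by omega))),
        Or.inl (Or.inr (mem_cons (s := fun i => p (m + 1 - i)) 0 (by omega))), Or.inr ?_⟩
      rw [← hr3 0 (by omega)]
      exact mem_cons 0 (by omega)

lemma conn {G : SimpleGraph V} (hstar : ¬ HasStarCutset G) (a : V) (K : Set V) (hK : a ∉ K)
    (hne : K.Nonempty) : (G.induce {y | (y = a ∨ G.Adj a y) → y ∈ K}).Connected := by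
  by_contra hcon
  apply hstar
  refine ⟨{y | (y = a ∨ G.Adj a y) → y ∈ K}ᶜ, ⟨?_, ?_⟩, a, ?_, ?_⟩
  · rw [compl_compl]
    obtain ⟨x, hx⟩ := hne
    exact ⟨x, fun _ => hx⟩
  · rwa [compl_compl]
  · intro h; exact hK (h (Or.inl rfl))
  · intro y hy
    simp only [Set.mem_compl_iff, Set.mem_setOf_eq, Classical.not_imp] at hy
    exact hy.1

lemma third {G : SimpleGraph V} (hdia : DiamondFree G)
    {a u v : V} (hau : G.Adj a u) (hav : G.Adj a v) (huv : ¬ G.Adj u v) (hne : u ≠ v)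
    (hclaw : IsClawCenter G a) : ∃ w, G.Adj a w ∧ w ≠ u ∧ w ≠ v ∧ ¬ G.Adj w u ∧ ¬ G.Adj w v := by
  obtain ⟨x, y, z, hx, hy, hz, hxy, hxz, hyz, nxy, nxz, nyz⟩ := hclaw
  have tr : ∀ b c d, G.Adj a b → G.Adj a c → G.Adj a d → G.Adj b c → G.Adj b d → c ≠ d →
      G.Adj c d := by
    intro b c d h1 h2 h3 h4 h5 h6
    by_contra h7
    exact hdia ⟨a, b, c, d, h1.ne, h2.ne, h3.ne, h4.ne, h5.ne, h6, h1, h2, h3, h4, h5, h7⟩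
  -- each of `u`, `v` is close to at most one of `x`, `y`, `z`
  have close : ∀ s, G.Adj a s → ∀ c d, G.Adj a c → G.Adj a d → c ≠ d → ¬ G.Adj c d →
      (c = s ∨ G.Adj c s) → (d = s ∨ G.Adj d s) → False := by
    intro s hs c d hc hd h1 h2 h3 h4
    rcases h3 with rfl | h3
    · rcases h4 with rfl | h4
      · exact h1 rfl
      · exact h2 h4.symm
    · rcases h4 with rfl | h4
      · exact h2 h3
      · exact h2 (tr s c d hs hc hd h3.symm h4.symm h1)
  by_contra hcon
  push Not at hcon
  have hc : ∀ w, G.Adj a w → (w = u ∨ G.Adj w u) ∨ (w = v ∨ G.Adj w v) := by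
    intro w hw
    by_contra h
    push Not at h
    exact h.2.2 (hcon w hw h.1.1 h.2.1 h.1.2)
  have cu := close u hau
  have cv := close v hav
  rcases hc x hx with h1 | h1 <;> rcases hc y hy with h2 | h2 <;> rcases hc z hz with h3 | h3
  all_goals first
    | exact cu x y hx hy hxy nxy h1 h2
    | exact cu x z hx hz hxz nxz h1 h3
    | exact cu y z hy hz hyz nyz h2 h3
    | exact cv x y hx hy hxy nxy h1 h2
    | exact cv x z hx hz hxz nxz h1 h3
    | exact cv y z hy hz hyz nyz h2 h3

lemma exists_conf {G : SimpleGraph V} (hstar : ¬ HasStarCutset G)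
    {a u v w : V} (hau : G.Adj a u) (hav : G.Adj a v) (huv : ¬ G.Adj u v) (hne : u ≠ v)
    (haw : G.Adj a w) (hwu : w ≠ u) (hwv : w ≠ v) (nwu : ¬ G.Adj w u) (nwv : ¬ G.Adj w v) :
    ∃ m k p r, Conf G a m k p r ∧ p 0 = u ∧ p (m + 1) = v ∧ r 0 = w := by
  have c1 := conn hstar a {u, v} (by simp [hau.ne, hav.ne]) ⟨u, by simp⟩
  obtain ⟨n, p, ⟨p0, pS, -⟩, pn, pip, -⟩ := exists_min (fun y => y = v)
    (exists_chain c1 (x := u) (y := v) (by simp) (by simp))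
  have hn0 : n ≠ 0 := by rintro rfl; exact hne (p0.symm.trans pn)
  have hn1 : n ≠ 1 := by
    rintro rfl
    apply huv
    rw [← p0, ← pn, pip.2 _ _ (by omega) (by omega)]; omega
  obtain ⟨m, rfl⟩ : ∃ m, n = m + 1 := ⟨n - 1, by omega⟩
  have pint : ∀ i, 1 ≤ i → i ≤ m → p i ≠ a ∧ ¬ G.Adj a (p i) := by
    intro i h1 h2
    rw [← not_or]
    intro h3
    rcases pS i (by omega) h3 with h4 | h4
    · have := pip.1 i 0 (by omega) (by omega) (h4.trans p0.symm)
      omega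
    · have := pip.1 i (m + 1) (by omega) (by omega) (h4.trans pn.symm)
      omega
  have c2 := conn hstar a {w} (by simp [haw.ne]) ⟨w, by simp⟩
  have hp1 : p 1 ∈ {y | (y = a ∨ G.Adj a y) → y ∈ ({w} : Set V)} := by
    intro h
    have := pint 1 le_rfl (by omega)
    tauto
  have hwp : ∀ j, j ≤ m + 1 → w ≠ p j := by
    intro j hj e
    by_cases h0 : j = 0
    · subst h0; exact hwu (e.trans p0)
    by_cases h1 : j = m + 1
    · subst h1; exact hwv (e.trans pn)
    exact (pint j (by omega) (by omega)).2 (e ▸ haw)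
  obtain ⟨k, r, ⟨r0, rS, -⟩, rT, rip, rmin⟩ :=
      exists_min (G := G) (S := {y | (y = a ∨ G.Adj a y) → y ∈ ({w} : Set V)}) (x := w)
      (fun y => ∃ j, 1 ≤ j ∧ j ≤ m ∧ G.Adj y (p j)) (by
    obtain ⟨l, s, ⟨s0, sS, sA⟩, sl⟩ := exists_chain c2 (x := w) (y := p 1) (by simp) hp1
    have hl : l ≠ 0 := by
      rintro rfl
      exact hwp 1 (by omega) (s0.symm.trans sl)
    refine ⟨l - 1, s, ⟨s0, fun i hi => sS i (by omega), fun i hi => sA i (by omega)⟩, 1, le_rfl,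
      by omega, ?_⟩
    have := sA (l - 1) (by omega)
    rwa [show l - 1 + 1 = l by omega, sl] at this)
  have rint : ∀ i, 1 ≤ i → i ≤ k → r i ≠ a ∧ ¬ G.Adj a (r i) := by
    intro i h1 h2
    rw [← not_or]
    intro h3
    have h4 : r i = w := rS i h2 h3
    have := rip.1 i 0 (by omega) (by omega) (h4.trans r0.symm)
    omega
  refine ⟨m, k, p, r, ?_, p0, pn, r0⟩
  refine ⟨by omega, pip, rip, ?_, ?_, ?_, ?_, ?_, ?_, ?_, rT⟩
  · intro i hi
    by_cases h0 : i = 0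
    · subst h0; rw [p0]; exact hau.ne'
    by_cases h1 : i = m + 1
    · subst h1; rw [pn]; exact hav.ne'
    exact (pint i (by omega) (by omega)).1
  · intro i hi
    by_cases h0 : i = 0
    · subst h0; rw [r0]; exact haw.ne'
    exact (rint i (by omega) (by omega)).1
  · intro i hi
    by_cases h0 : i = 0
    · subst h0; rw [p0]; simp [hau]
    by_cases h1 : i = m + 1
    · subst h1; rw [pn]; simp [hav]
    have := (pint i (by omega) (by omega)).2
    simp [h0, h1, this]
  · intro i hi
    by_cases h0 : i = 0
    · subst h0; rw [r0]; simp [haw]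
    have := (rint i (by omega) (by omega)).2
    simp [h0, this]
  · intro i j hi hj e
    by_cases hi0 : i = 0
    · subst hi0; exact hwp j hj (r0.symm.trans e)
    have hr := (rint i (by omega) hi).2
    by_cases h0 : j = 0
    · subst h0; rw [e, p0] at hr; exact hr hau
    by_cases h1 : j = m + 1
    · subst h1; rw [e, pn] at hr; exact hr hav
    refine rmin (i - 1) (by omega) ⟨j, by omega, by omega, ?_⟩
    rw [← e, rip.2 _ _ (by omega) (by omega)]; omega
  · rintro j (rfl | rfl)
    · rw [r0, p0]; exact nwu
    · rw [r0, pn]; exact nwv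
  · intro i j hi h1 h2 h3
    exact rmin i hi ⟨j, h1, h2, h3⟩

end Seagull

/-- Lemma 4.5: in a (clock, diamond)-free graph with no star cutset, a seagull
`a,u,v` whose center `a` is a claw center extends to a theta with end `a` or a
pyramid with apex `a` containing `a, u, v`, in which `a` is still a claw center. -/
theorem seagull_three_path_configuration (G : SimpleGraph V)
    (hclock : ClockFree G) (hdia : DiamondFree G) (hstar : ¬ HasStarCutset G)
    (a u v : V) (hau : G.Adj a u) (hav : G.Adj a v) (huv : ¬ G.Adj u v) (hne : u ≠ v)
    (hclaw : IsClawCenter G a) :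
    ∃ Q : Set V,
      ((∃ b, IsThetaWithEnds G Q a b) ∨ IsPyramidWithApex G Q a) ∧
      a ∈ Q ∧ u ∈ Q ∧ v ∈ Q ∧
      (∃ x y z, x ∈ Q ∧ y ∈ Q ∧ z ∈ Q ∧ G.Adj a x ∧ G.Adj a y ∧ G.Adj a z ∧
        x ≠ y ∧ x ≠ z ∧ y ≠ z ∧ ¬ G.Adj x y ∧ ¬ G.Adj x z ∧ ¬ G.Adj y z) := by
  obtain ⟨w, haw, hwu, hwv, nwu, nwv⟩ := Seagull.third hdia hau hav huv hne hclaw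
  obtain ⟨m, k, p, r, hconf, rfl, rfl, rfl⟩ :=
    Seagull.exists_conf hstar hau hav huv hne haw hwu hwv nwu nwv
  obtain ⟨Q, hQ, h1, h2, h3, h4⟩ := hconf.final hclock
  exact ⟨Q, hQ, h1, h2, h3, p 0, p (m + 1), r 0, h2, h3, h4, hau, hav, haw, hne, hwu.symm, hwv.symm,
    huv, fun h => nwu h.symm, fun h => nwv h.symm⟩
end

section
/- Let G be a graph, c ∈ [1/2, 1), and k a positive integer. If for every weight function w on G there is a (w, c)-balanced separator of size at most k, then the treewidth of G is at most k/(1−c). -/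
open SimpleGraph

variable {V : Type*}

namespace BSTW

universe u

/-- `u` and `v` are joined by a walk inside `S`. -/
def ConnIn {V : Type*} (G : SimpleGraph V) (S : Set V) (u v : V) : Prop :=
  ∃ p : G.Walk u v, ∀ x ∈ p.support, x ∈ S

section conn
variable {V : Type*} {G : SimpleGraph V} {S S' : Set V} {u v w : V}

lemma ConnIn.refl (h : u ∈ S) : ConnIn G S u u := ⟨.nil, by simpa using h⟩

lemma ConnIn.symm (h : ConnIn G S u v) : ConnIn G S v u := by
  obtain ⟨p, hp⟩ := h
  exact ⟨p.reverse, by simpa using hp⟩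

lemma ConnIn.trans (h : ConnIn G S u v) (h' : ConnIn G S v w) : ConnIn G S u w := by
  obtain ⟨p, hp⟩ := h
  obtain ⟨q, hq⟩ := h'
  refine ⟨p.append q, fun x hx => ?_⟩
  rw [SimpleGraph.Walk.mem_support_append_iff] at hx
  exact hx.elim (hp x) (hq x)

lemma ConnIn.mono (h : ConnIn G S u v) (hs : S ⊆ S') : ConnIn G S' u v := by
  obtain ⟨p, hp⟩ := h
  exact ⟨p, fun x hx => hs (hp x hx)⟩

lemma ConnIn.left_mem (h : ConnIn G S u v) : u ∈ S := by
  obtain ⟨p, hp⟩ := h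
  exact hp _ p.start_mem_support

lemma ConnIn.right_mem (h : ConnIn G S u v) : v ∈ S := by
  obtain ⟨p, hp⟩ := h
  exact hp _ p.end_mem_support

lemma ConnIn.of_adj (hu : u ∈ S) (hv : v ∈ S) (h : G.Adj u v) : ConnIn G S u v :=
  ⟨.cons h .nil, by simp [hu, hv]⟩

lemma ConnIn.map {V' : Type*} {G' : SimpleGraph V'} {S' : Set V'} (h : ConnIn G S u v)
    (f : G →g G') (hf : ∀ x ∈ S, f x ∈ S') : ConnIn G' S' (f u) (f v) := by
  obtain ⟨p, hp⟩ := h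
  refine ⟨p.map f, fun x hx => ?_⟩
  rw [SimpleGraph.Walk.support_map, List.mem_map] at hx
  obtain ⟨y, hy, rfl⟩ := hx
  exact hf y (hp y hy)

lemma induce_of_connIn (hne : S.Nonempty) (h : ∀ u ∈ S, ∀ v ∈ S, ConnIn G S u v) :
    (G.induce S).Connected := by
  have := hne.to_subtype
  refine ⟨fun a b => ?_⟩
  obtain ⟨p, hp⟩ := h a a.2 b b.2
  exact ⟨p.induce S hp⟩

/-- the set of vertices reachable inside `S` is connected inside itself -/
lemma ConnIn.reach (h : ConnIn G S u v) : ConnIn G {x | ConnIn G S u x} u v := by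
  classical
  obtain ⟨p, hp⟩ := h
  exact ⟨p, fun x hx =>
    ⟨p.takeUntil x hx, fun y hy => hp y (p.support_takeUntil_subset_support hx hy)⟩⟩

end conn

section sumTree
variable {α β : Type*} {A : SimpleGraph α} {B : SimpleGraph β}

lemma sum_isAcyclic_inl (hA : A.IsAcyclic) (a : α) (p : (A ⊕g B).Walk (.inl a) (.inl a)) :
    ¬ p.IsCycle := by
  intro hp
  have hs : ∀ x ∈ p.support, x ∈ Set.range (Sum.inl : α → α ⊕ β) := by
    classical
    intro x hx
    rcases x with x | x
    · exact ⟨x, rfl⟩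
    · exact (SimpleGraph.not_reachable_sum_inl_inr _ _ ⟨p.takeUntil _ hx⟩).elim
  have h1 : ((A ⊕g B).induce (Set.range (Sum.inl : α → α ⊕ β))).IsAcyclic :=
    ((SimpleGraph.Embedding.sumInl (G := A) (H := B)).isoInduceRange.isAcyclic_iff).1 hA
  apply h1 (p.induce _ hs)
  have := p.map_induce hs
  rw [← SimpleGraph.Walk.isCycle_map_iff_of_injective
    (f := (SimpleGraph.Embedding.induce _).toHom) Subtype.val_injective]
  rwa [this]

lemma sum_isAcyclic (hA : A.IsAcyclic) (hB : B.IsAcyclic) : (A ⊕g B).IsAcyclic := by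
  intro x p hp
  rcases x with x | x
  · exact sum_isAcyclic_inl hA x p hp
  · refine sum_isAcyclic_inl (B := A) hB x
      (p.map (SimpleGraph.Iso.sumComm (G := A) (H := B)).toHom) ?_
    exact (SimpleGraph.Walk.isCycle_map_iff_of_injective
      (SimpleGraph.Iso.sumComm (G := A) (H := B)).injective).2 hp

lemma glue_isTree (hA : A.IsTree) (hB : B.IsTree) (a : α) (b : β) :
    ((A ⊕g B) ⊔ SimpleGraph.edge (Sum.inl a) (Sum.inr b)).IsTree :=
  ⟨hA.connected.sum_sup_edge hB.connected,
    (sum_isAcyclic hA.isAcyclic hB.isAcyclic).sup_edge_of_not_reachable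
      (SimpleGraph.not_reachable_sum_inl_inr _ _)⟩

end sumTree

variable {V : Type u}

/-- `X` meets every member of `B`. -/
def Covers (B : Set (Set V)) (X : Set V) : Prop := ∀ U ∈ B, ∃ x ∈ U, x ∈ X

def Touch (G : SimpleGraph V) (U U' : Set V) : Prop :=
  ∃ u ∈ U, ∃ v ∈ U', u = v ∨ G.Adj u v

structure IsBramble (G : SimpleGraph V) (B : Set (Set V)) : Prop where
  ne : ∀ U ∈ B, U.Nonempty
  conn : ∀ U ∈ B, ∀ u ∈ U, ∀ v ∈ U, ConnIn G U u v
  touch : ∀ U ∈ B, ∀ U' ∈ B, Touch G U U'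

/-- `(T, τ)` is a tree decomposition of `G[S]`. -/
structure IsTD (G : SimpleGraph V) (S : Set V) {ι : Type} (T : SimpleGraph ι)
    (τ : ι → Set V) : Prop where
  tree : T.IsTree
  sub : ∀ t, τ t ⊆ S
  vert : ∀ v ∈ S, ∃ t, v ∈ τ t
  edge : ∀ u ∈ S, ∀ v ∈ S, G.Adj u v → ∃ t, u ∈ τ t ∧ v ∈ τ t
  conn : ∀ v t t', v ∈ τ t → v ∈ τ t' → ConnIn T {t | v ∈ τ t} t t'

/-- there is a `B`-admissible tree decomposition of `G[S]` with `X` contained in some bag -/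
def HasTD (G : SimpleGraph V) (B : Set (Set V)) (K : ℕ) (S X : Set V) : Prop :=
  ∃ (ι : Type) (T : SimpleGraph ι) (τ : ι → Set V) (r : ι), IsTD G S T τ ∧ X ⊆ τ r ∧
    ∀ t, Covers B (τ t) → (τ t).ncard ≤ K

lemma hasTD_single (G : SimpleGraph V) (B : Set (Set V)) (K : ℕ) (S : Set V)
    (h : Covers B S → S.ncard ≤ K) : HasTD G B K S S := by
  refine ⟨Unit, ⊥, fun _ => S, (), ⟨.of_subsingleton, fun _ => subset_rfl, fun v hv => ⟨(), hv⟩,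
    fun u hu v hv _ => ⟨(), hu, hv⟩, fun v t t' h _ => ConnIn.refl h⟩, subset_rfl, fun _ => h⟩

lemma HasTD.glue {G : SimpleGraph V} {B : Set (Set V)} {K : ℕ} {S₁ S₂ X₁ X₂ : Set V}
    (h₁ : HasTD G B K S₁ X₁) (h₂ : HasTD G B K S₂ X₂)
    (hX₁ : S₁ ∩ S₂ ⊆ X₁) (hX₂ : S₁ ∩ S₂ ⊆ X₂)
    (hE : ∀ u ∈ S₁, ∀ v ∈ S₂, G.Adj u v → v ∈ S₁ ∨ u ∈ S₂) :
    HasTD G B K (S₁ ∪ S₂) X₁ := by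
  obtain ⟨ι, T, τ, r, h, hr, ha⟩ := h₁
  obtain ⟨ι', T', τ', r', h', hr', ha'⟩ := h₂
  set TT := (T ⊕g T') ⊔ SimpleGraph.edge (.inl r) (.inr r') with hTT
  have hTl : ∀ (v : V) (t t'), ConnIn T {t | v ∈ τ t} t t' →
      ConnIn TT {t | v ∈ Sum.elim τ τ' t} (.inl t) (.inl t') := by
    intro v t t' hv
    exact hv.map ((SimpleGraph.Hom.ofLE le_sup_left).comp
      (SimpleGraph.Embedding.sumInl (H := T')).toHom) (fun x hx => hx)
  have hTr : ∀ (v : V) (t t'), ConnIn T' {t | v ∈ τ' t} t t' →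
      ConnIn TT {t | v ∈ Sum.elim τ τ' t} (.inr t) (.inr t') := by
    intro v t t' hv
    exact hv.map ((SimpleGraph.Hom.ofLE le_sup_left).comp
      (SimpleGraph.Embedding.sumInr (G := T)).toHom) (fun x hx => hx)
  have hmid : ∀ (v : V) (t t'), v ∈ τ t → v ∈ τ' t' →
      ConnIn TT {t | v ∈ Sum.elim τ τ' t} (.inl t) (.inr t') := by
    intro v t t' hv hv'
    have hvS : v ∈ S₁ ∩ S₂ := ⟨h.sub _ hv, h'.sub _ hv'⟩
    have hvr := hr (hX₁ hvS)
    have hvr' := hr' (hX₂ hvS)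
    refine (hTl v t r (h.conn v t r hv hvr)).trans (.trans ?_ (hTr v r' t' (h'.conn v r' t' hvr' hv')))
    exact ConnIn.of_adj hvr hvr' (by simp [hTT, SimpleGraph.edge])
  refine ⟨ι ⊕ ι', TT, Sum.elim τ τ', .inl r, ⟨glue_isTree h.tree h'.tree r r', ?_, ?_, ?_, ?_⟩,
    hr, ?_⟩
  · rintro (t | t)
    · exact (h.sub t).trans Set.subset_union_left
    · exact (h'.sub t).trans Set.subset_union_right
  · rintro v (hv | hv)
    · obtain ⟨t, ht⟩ := h.vert v hv
      exact ⟨.inl t, ht⟩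
    · obtain ⟨t, ht⟩ := h'.vert v hv
      exact ⟨.inr t, ht⟩
  · have e1 : ∀ u ∈ S₁, ∀ v ∈ S₁, G.Adj u v →
        ∃ t, u ∈ Sum.elim τ τ' t ∧ v ∈ Sum.elim τ τ' t := by
      intro u hu v hv huv
      obtain ⟨t, ht⟩ := h.edge u hu v hv huv
      exact ⟨.inl t, ht⟩
    have e2 : ∀ u ∈ S₂, ∀ v ∈ S₂, G.Adj u v →
        ∃ t, u ∈ Sum.elim τ τ' t ∧ v ∈ Sum.elim τ τ' t := by
      intro u hu v hv huv
      obtain ⟨t, ht⟩ := h'.edge u hu v hv huv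
      exact ⟨.inr t, ht⟩
    rintro u (hu | hu) v (hv | hv) huv
    · exact e1 u hu v hv huv
    · exact (hE u hu v hv huv).elim (fun q => e1 u hu v q huv) (fun q => e2 u q v hv huv)
    · exact (hE v hv u hu huv.symm).elim (fun q => e1 u q v hv huv) (fun q => e2 u hu v q huv)
    · exact e2 u hu v hv huv
  · rintro v (t | t) (t' | t') hv hv'
    · exact hTl v t t' (h.conn v t t' hv hv')
    · exact hmid v t t' hv hv'
    · exact (hmid v t' t hv' hv).symm
    · exact hTr v t t' (h'.conn v t t' hv hv')
  · rintro (t | t)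
    · exact ha t
    · have hbound := ha' t
      exact hbound

/-- bags met by a walk form a connected subset of the decomposition tree -/
lemma IsTD.walk_conn {G : SimpleGraph V} {ι : Type} {T : SimpleGraph ι} {τ : ι → Set V}
    (h : IsTD G Set.univ T τ) {u v : V} (p : G.Walk u v) :
    ∀ t t', u ∈ τ t → v ∈ τ t' → ConnIn T {t | ∃ w ∈ p.support, w ∈ τ t} t t' := by
  induction p with
  | nil =>
    intro t t' ht ht'
    exact (h.conn _ t t' ht ht').mono (fun s hs => ⟨_, by simp, hs⟩)
  | @cons u w v huw p ih =>
    intro t t' ht ht'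
    obtain ⟨s, hs, hs'⟩ := h.edge u trivial w trivial huw
    refine ((h.conn u t s ht hs).mono (fun (s : ι) hs => (⟨u, by simp, hs⟩ : ∃ w ∈ _, w ∈ τ s))).trans
      ((ih s t' hs' ht').mono ?_)
    rintro s ⟨x, hx, hxs⟩
    exact ⟨x, by simp [hx], hxs⟩

/-- every bag on the tree path between `s` and `t` meets a walk from bag `s` to bag `t` -/
lemma IsTD.walk_meets {G : SimpleGraph V} {ι : Type} {T : SimpleGraph ι} {τ : ι → Set V}
    (h : IsTD G Set.univ T τ) {u v : V} (p : G.Walk u v) {s t : ι} (hs : u ∈ τ s) (ht : v ∈ τ t)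
    (P : T.Path s t) {x : ι} (hx : x ∈ P.1.support) : ∃ w ∈ p.support, w ∈ τ x := by
  classical
  obtain ⟨q, hq⟩ := h.walk_conn p s t hs ht
  have : P = q.toPath := (h.tree.isAcyclic.subsingleton_path _ _).elim _ _
  rw [this] at hx
  exact hq x (q.support_toPath_subset_support hx)

/-- the part of a walk from outside `C` up to its first vertex in `X` -/
lemma first_hit {G : SimpleGraph V} {X C : Set V}
    (hC : ∀ u ∈ C, ∀ v, G.Adj u v → v ∉ X → v ∈ C) {y x : V} (p : G.Walk y x) :
    x ∈ X → y ∉ C → ∃ x' ∈ X, ∃ q : G.Walk y x', (∀ v ∈ q.support, v ∈ p.support) ∧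
      ∀ v ∈ q.support, v = x' ∨ (v ∉ X ∧ v ∉ C) := by
  induction p with
  | nil => exact fun hx _ => ⟨_, hx, .nil, by simp, by simp⟩
  | @cons y z x hyz p ih =>
    intro hx hy
    by_cases hyX : y ∈ X
    · exact ⟨y, hyX, .nil, by simp, by simp⟩
    · have hz : z ∉ C := fun hz => hy (hC z hz y hyz.symm hyX)
      obtain ⟨x', hx', q, hq, hq'⟩ := ih hx hz
      refine ⟨x', hx', .cons hyz q, ?_, ?_⟩
      · intro v hv
        rw [SimpleGraph.Walk.support_cons, List.mem_cons] at hv ⊢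
        exact hv.imp id (hq v)
      · intro v hv
        rw [SimpleGraph.Walk.support_cons, List.mem_cons] at hv
        rcases hv with rfl | hv
        · exact Or.inr ⟨hyX, hy⟩
        · exact hq' v hv

/-- The key step: from a tree decomposition of `G` with a big bag covering `B`. -/
lemma modify [Finite V] {G : SimpleGraph V} {B : Set (Set V)} (hB : IsBramble G B) {K : ℕ}
    {X C : Set V} (hXK : X.ncard ≤ K) (hXB : Covers B X)
    (hmin : ∀ Z, Covers B Z → X.ncard ≤ Z.ncard)
    (hC : ∀ u ∈ C, ∀ v, G.Adj u v → v ∉ X → v ∈ C)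
    {ι : Type} {T : SimpleGraph ι} {τ : ι → Set V} (h : IsTD G Set.univ T τ)
    (ha : ∀ t, Covers (insert C B) (τ t) → (τ t).ncard ≤ K)
    {s : ι} (hs : Covers B (τ s)) (hsK : K < (τ s).ncard) :
    HasTD G B K (X ∪ C) X := by
  classical
  have hsC : ∀ y ∈ τ s, y ∉ C := by
    intro y hy hyC
    refine absurd (ha s ?_) (not_le.2 hsK)
    rintro U (rfl | hU)
    · exact ⟨y, hyC, hy⟩
    · exact hs U hU
  choose f hf using fun v => h.vert v trivial
  have hP : ∀ v, Nonempty (T.Path s (f v)) := fun v =>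
    ⟨(h.tree.connected.preconnected s (f v)).some.toPath⟩
  let P := fun v => (hP v).some
  let W : ι → Set V := fun t => (τ t ∩ (X ∪ C)) ∪ {x | x ∈ X ∧ t ∈ (P x).1.support}
  have hcard : ∀ t, (W t).ncard ≤ (τ t).ncard := by
    intro t
    let R : Set V := {x | x ∈ X ∧ x ∉ τ t ∧ t ∈ (P x).1.support}
    have hZ : Covers B ((X \ R) ∪ (τ t \ (X ∪ C))) := by
      intro U hU
      by_contra hcon
      push Not at hcon
      obtain ⟨x0, hx0U, hx0⟩ := hXB U hU
      obtain ⟨y, hyU, hy⟩ := hs U hU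
      obtain ⟨p, hp⟩ := hB.conn U hU y hyU x0 hx0U
      obtain ⟨x', hx', q, hq, hq'⟩ := first_hit hC p hx0 (hsC y hy)
      have hx'U : x' ∈ U := hp _ (hq _ q.end_mem_support)
      have hx'R : x' ∈ R := by
        by_contra hR
        exact hcon x' hx'U (Or.inl ⟨hx', hR⟩)
      obtain ⟨w, hw, hwt⟩ := h.walk_meets q hy (hf x') (P x') hx'R.2.2
      rcases hq' w hw with rfl | ⟨h1, h2⟩
      · exact hx'R.2.1 hwt
      · exact hcon w (hp _ (hq _ hw)) (Or.inr ⟨hwt, by simp [h1, h2]⟩)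
    have h1 := hmin _ hZ
    have h2 := Set.ncard_union_le (X \ R) (τ t \ (X ∪ C))
    have h3 : (X \ R).ncard + R.ncard = X.ncard :=
      Set.ncard_sdiff_add_ncard_of_subset (fun x hx => hx.1)
    have h4 : W t ⊆ (τ t ∩ (X ∪ C)) ∪ R := by
      rintro x (hx | hx)
      · exact Or.inl hx
      · by_cases hxt : x ∈ τ t
        · exact Or.inl ⟨hxt, Or.inl hx.1⟩
        · exact Or.inr ⟨hx.1, hxt, hx.2⟩
    have h5 := Set.ncard_le_ncard h4
    have h6 := Set.ncard_union_le (τ t ∩ (X ∪ C)) R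
    have h7 := Set.ncard_inter_add_ncard_sdiff_eq_ncard (τ t) (X ∪ C)
    omega
  have hW : ∀ v t, v ∈ τ t → v ∈ X ∪ C → v ∈ W t := fun v t h1 h2 => Or.inl ⟨h1, h2⟩
  refine ⟨ι, T, W, s, ⟨h.tree, ?_, ?_, ?_, ?_⟩, ?_, ?_⟩
  · rintro t x (hx | hx)
    · exact hx.2
    · exact Or.inl hx.1
  · intro v hv
    exact ⟨f v, hW _ _ (hf v) hv⟩
  · intro u hu v hv huv
    obtain ⟨t, h1, h2⟩ := h.edge u trivial v trivial huv
    exact ⟨t, hW _ _ h1 hu, hW _ _ h2 hv⟩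
  · have key : ∀ v t, v ∈ W t → ConnIn T {t | v ∈ W t} t (f v) := by
      rintro v t (hv | hv)
      · exact (h.conn v t (f v) hv.1 (hf v)).mono (fun x hx => hW v x hx hv.2)
      · exact ⟨(P v).1.dropUntil t hv.2, fun x hx =>
          Or.inr ⟨hv.1, (P v).1.support_dropUntil_subset_support hv.2 hx⟩⟩
    intro v t t' hv hv'
    exact (key v t hv).trans (key v t' hv').symm
  · intro x hx
    exact Or.inr ⟨hx, (P x).1.start_mem_support⟩
  · intro t ht
    by_contra hlt
    have h1 : ¬ Covers (insert C B) (τ t) := fun hc => hlt ((hcard t).trans (ha t hc))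
    unfold Covers at h1
    push Not at h1
    obtain ⟨U, hU, hUt⟩ := h1
    rcases hU with rfl | hU
    · apply hlt
      refine (Set.ncard_le_ncard (?_ : W t ⊆ X)).trans hXK
      rintro x (⟨hx, hx' | hx'⟩ | hx)
      · exact hx'
      · exact (hUt x hx' hx).elim
      · exact hx.1
    · obtain ⟨x, hxU, hx⟩ := ht U hU
      rcases hx with hx | hx
      · exact hUt x hxU hx.1
      · obtain ⟨y, hyU, hy⟩ := hs U hU
        obtain ⟨p, hp⟩ := hB.conn U hU y hyU x hxU
        obtain ⟨w, hw, hwt⟩ := h.walk_meets p hy (hf x) (P x) hx.2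
        exact hUt w (hp w hw) hwt

/-- Seymour–Thomas, hard direction. -/
lemma exists_admissible [Finite V] (G : SimpleGraph V) (K : ℕ)
    (hK : ∀ B, IsBramble G B → ∃ X, Covers B X ∧ X.ncard ≤ K) (B : Set (Set V)) :
    IsBramble G B → HasTD G B K Set.univ ∅ := by
  classical
  induction B using WellFoundedGT.induction with
  | ind B ih =>
  intro hB
  by_contra hno
  obtain ⟨X, hXB, hmin⟩ : ∃ X, Covers B X ∧ ∀ Z, Covers B Z → X.ncard ≤ Z.ncard := by
    obtain ⟨X0, hX0, _⟩ := hK B hB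
    obtain ⟨X, hX, hm⟩ := exists_minimalFor_of_wellFoundedLT (Covers B) Set.ncard ⟨X0, hX0⟩
    refine ⟨X, hX, fun Z hZ => ?_⟩
    rcases le_total X.ncard Z.ncard with h | h
    · exact h
    · exact hm hZ h
  have hXK : X.ncard ≤ K := by
    obtain ⟨X0, hX0, h0⟩ := hK B hB
    exact (hmin X0 hX0).trans h0
  -- the component of `x`
  have hcomp : ∀ x ∉ X, HasTD G B K (X ∪ {v | ConnIn G Xᶜ x v}) X := by
    intro x hx
    set C := {v | ConnIn G Xᶜ x v} with hCdef
    have hCX : ∀ v ∈ C, v ∉ X := fun v hv => ConnIn.right_mem hv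
    have hC : ∀ u ∈ C, ∀ v, G.Adj u v → v ∉ X → v ∈ C := fun u hu v huv hv =>
      ConnIn.trans hu (.of_adj (hCX u hu) hv huv)
    have hxC : x ∈ C := ConnIn.refl hx
    by_cases htouch : ∀ U ∈ B, Touch G C U
    · have hB' : IsBramble G (insert C B) := by
        refine ⟨?_, ?_, ?_⟩
        · rintro U (rfl | hU)
          · exact ⟨x, hxC⟩
          · exact hB.ne U hU
        · rintro U (rfl | hU)
          · intro u hu v hv
            exact (ConnIn.reach hu).symm.trans (ConnIn.reach hv)
          · exact hB.conn U hU
        · rintro U (rfl | hU) U' (rfl | hU')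
          · exact ⟨x, hxC, x, hxC, Or.inl rfl⟩
          · exact htouch U' hU'
          · obtain ⟨u, hu, v, hv, huv⟩ := htouch U hU
            exact ⟨v, hv, u, hu, huv.imp Eq.symm fun e => e.symm⟩
          · exact hB.touch U hU U' hU'
      have hCB : C ∉ B := by
        intro hCB
        obtain ⟨y, hy, hyX⟩ := hXB C hCB
        exact hCX y hy hyX
      obtain ⟨ι, T, τ, r, h, _, ha⟩ := ih (insert C B) (Set.ssubset_insert hCB) hB'
      by_cases hadm : ∀ t, Covers B (τ t) → (τ t).ncard ≤ K
      · exact (hno ⟨ι, T, τ, r, h, Set.empty_subset _, hadm⟩).elim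
      · push Not at hadm
        obtain ⟨s, hs, hsK⟩ := hadm
        exact modify hB hXK hXB hmin hC h ha hs hsK
    · unfold Touch at htouch
      push Not at htouch
      obtain ⟨U, hU, hUC⟩ := htouch
      let Y : Set V := C ∪ {v | ∃ u ∈ C, G.Adj u v}
      have hY : ¬ Covers B Y := by
        intro hc
        obtain ⟨y, hyU, hy⟩ := hc U hU
        rcases hy with hy | ⟨u, hu, huy⟩
        · exact (hUC y hy y hyU).1 rfl
        · exact (hUC u hu y hyU).2 huy
      have hg := (hasTD_single G B K X (fun _ => hXK)).glue
        (hasTD_single G B K Y (fun hc => (hY hc).elim)) Set.inter_subset_left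
        Set.inter_subset_right (by
          intro u hu v hv huv
          rcases hv with hv | ⟨w, hw, hwv⟩
          · exact Or.inr (Or.inr ⟨v, hv, huv.symm⟩)
          · by_cases hvX : v ∈ X
            · exact Or.inl hvX
            · exact Or.inr (Or.inr ⟨v, hC w hw v hwv hvX, huv.symm⟩))
      have : X ∪ Y = X ∪ C := by
        ext v
        constructor
        · rintro (hv | hv | ⟨w, hw, hwv⟩)
          · exact Or.inl hv
          · exact Or.inr hv
          · by_cases hvX : v ∈ X
            · exact Or.inl hvX
            · exact Or.inr (hC w hw v hwv hvX)
        · rintro (hv | hv)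
          · exact Or.inl hv
          · exact Or.inr (Or.inl hv)
      rwa [this] at hg
  have hall : ∀ F : Finset V, ∃ S, X ⊆ S ∧ (F : Set V) ⊆ S ∧
      (∀ u ∈ S, u ∉ X → ∀ v, ConnIn G Xᶜ u v → v ∈ S) ∧ HasTD G B K S X := by
    intro F
    induction F using Finset.induction_on with
    | empty => exact ⟨X, subset_rfl, by simp, fun u hu hu' => (hu' hu).elim,
        hasTD_single G B K X (fun _ => hXK)⟩
    | @insert x F _ ihF =>
      obtain ⟨S, hXS, hFS, hcl, hTD⟩ := ihF
      by_cases hxS : x ∈ S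
      · exact ⟨S, hXS, by simp [Set.insert_subset_iff, hxS, hFS], hcl, hTD⟩
      · have hxX : x ∉ X := fun h => hxS (hXS h)
        have hdis : ∀ v ∈ S, v ∉ X → ¬ ConnIn G Xᶜ x v := fun v hv hvX hc =>
          hxS (hcl v hv hvX x hc.symm)
        refine ⟨S ∪ (X ∪ {v | ConnIn G Xᶜ x v}), hXS.trans Set.subset_union_left, ?_, ?_, ?_⟩
        · rw [Finset.coe_insert, Set.insert_subset_iff]
          exact ⟨Or.inr (Or.inr (ConnIn.refl hxX)), hFS.trans Set.subset_union_left⟩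
        · rintro u (hu | hu | hu) huX v huv
          · exact Or.inl (hcl u hu huX v huv)
          · exact (huX hu).elim
          · exact Or.inr (Or.inr (ConnIn.trans hu huv))
        · have hin : S ∩ (X ∪ {v | ConnIn G Xᶜ x v}) ⊆ X := by
            rintro v ⟨hv, hv' | hv'⟩
            · exact hv'
            · by_contra hvX
              exact hdis v hv hvX hv'
          refine hTD.glue (hcomp x hxX) hin hin ?_
          rintro u hu v (hv | hv) huv
          · exact Or.inl (hXS hv)
          · by_cases huX : u ∈ X
            · exact Or.inr (Or.inl huX)
            · exact Or.inl (hcl u hu huX v (.of_adj huX (ConnIn.right_mem hv) huv))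
  have := Fintype.ofFinite V
  obtain ⟨S, _, hS, _, ι, T, τ, r, h, _, ha⟩ := hall Finset.univ
  have : S = Set.univ := by
    rw [Finset.coe_univ] at hS
    exact Set.univ_subset_iff.1 hS
  subst this
  exact hno ⟨ι, T, τ, r, h, Set.empty_subset _, ha⟩

open scoped Classical in
lemma bramble_order [Fintype V] (G : SimpleGraph V)
    (c : ℝ) (hc : 1/2 ≤ c ∧ c < 1) (k : ℕ)
    (h : ∀ w : V → ℝ, IsWeightFun w →
      ∃ X : Set V, IsBalancedSep G w c X ∧ X.ncard ≤ k) (B : Set (Set V)) (hB : IsBramble G B) :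
    ∃ X, Covers B X ∧ X.ncard ≤ ⌊(k : ℝ) / (1 - c)⌋₊ := by
  have hc1 : 0 < 1 - c := by linarith [hc.2]
  obtain ⟨W, hW, hmin⟩ : ∃ X, Covers B X ∧ ∀ Z, Covers B Z → X.ncard ≤ Z.ncard := by
    have hX0 : Covers B Set.univ := fun U hU => by
      obtain ⟨x, hx⟩ := hB.ne U hU
      exact ⟨x, hx, trivial⟩
    obtain ⟨X, hX, hm⟩ := exists_minimalFor_of_wellFoundedLT (Covers B) Set.ncard ⟨_, hX0⟩
    refine ⟨X, hX, fun Z hZ => ?_⟩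
    rcases le_total X.ncard Z.ncard with h | h
    · exact h
    · exact hm hZ h
  refine ⟨W, hW, ?_⟩
  by_contra hlt
  have hlt : (k : ℝ) / (1 - c) < W.ncard := by
    rw [not_le, Nat.floor_lt (by positivity)] at hlt
    exact hlt
  rw [div_lt_iff₀ hc1] at hlt
  have hn : (0 : ℝ) < W.ncard := by
    by_contra hn
    have hk : (0 : ℝ) ≤ k := by positivity
    nlinarith
  have hsum : ∀ S : Set V, wSum (W.indicator fun _ => (1 : ℝ) / W.ncard) S
      = (S ∩ W).ncard / W.ncard := by
    intro S
    unfold wSum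
    simp_rw [Set.indicator_indicator]
    rw [Set.ncard_eq_toFinset_card' (S ∩ W), div_eq_mul_one_div ((S ∩ W).toFinset.card : ℝ),
      ← nsmul_eq_mul, ← Finset.sum_const,
      ← Finset.sum_indicator_subset _ (Finset.subset_univ (S ∩ W).toFinset), Set.coe_toFinset]
  have hwt : IsWeightFun (W.indicator fun _ => (1 : ℝ) / W.ncard) := by
    refine ⟨fun v => ?_, ?_⟩
    · have h1 : (1 : ℝ) ≤ W.ncard := by exact_mod_cast hn
      by_cases hv : v ∈ W
      · rw [Set.indicator_of_mem hv]
        exact ⟨by positivity, by rw [div_le_one hn]; exact h1⟩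
      · rw [Set.indicator_of_notMem hv]
        norm_num
    · have := hsum Set.univ
      unfold wSum at this
      rw [Set.univ_inter, div_self hn.ne'] at this
      simpa using this
  obtain ⟨X, hX, hXk⟩ := h _ hwt
  have hXk' : (X.ncard : ℝ) ≤ k := by exact_mod_cast hXk
  have hXn : ¬ Covers B X := by
    intro hcov
    have h1 : (W.ncard : ℝ) ≤ X.ncard := by exact_mod_cast hmin X hcov
    nlinarith [hc.1]
  unfold Covers at hXn
  push Not at hXn
  obtain ⟨U0, hU0, hU0X⟩ := hXn
  obtain ⟨x, hx⟩ := hB.ne U0 hU0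
  set D := {v | ConnIn G Xᶜ x v} with hD
  have hxD : x ∈ D := ConnIn.refl (hU0X x hx)
  have hDX : D ⊆ Xᶜ := fun v hv => ConnIn.right_mem hv
  have hcompD : IsComponentOf G Xᶜ D := by
    refine ⟨⟨x, hxD⟩, hDX, induce_of_connIn ⟨x, hxD⟩ ?_, ?_⟩
    · intro u hu v hv
      exact (ConnIn.reach hu).symm.trans (ConnIn.reach hv)
    · intro u hu v hv hvD huv
      exact hvD (ConnIn.trans hu (.of_adj (hDX hu) hv huv))
  have hle := hX D hcompD
  rw [hsum, div_le_iff₀ hn] at hle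
  have hcov : Covers B (X ∪ (D ∩ W)) := by
    intro U hU
    by_contra hcon
    push Not at hcon
    have hUX : U ⊆ Xᶜ := fun y hy hyX => hcon y hy (Or.inl hyX)
    obtain ⟨u, hu, v, hv, huv⟩ := hB.touch U0 hU0 U hU
    have hU0X' : U0 ⊆ Xᶜ := hU0X
    have huD : ConnIn G Xᶜ x u := (hB.conn U0 hU0 x hx u hu).mono hU0X'
    have hvD : ConnIn G Xᶜ x v := by
      rcases huv with rfl | huv
      · exact huD
      · exact huD.trans (.of_adj (hU0X' hu) (hUX hv) huv)
    obtain ⟨y, hyU, hyW⟩ := hW U hU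
    exact hcon y hyU (Or.inr ⟨hvD.trans ((hB.conn U hU v hv y hyU).mono hUX), hyW⟩)
  have h1 : (W.ncard : ℝ) ≤ X.ncard + (D ∩ W).ncard := by
    exact_mod_cast (hmin _ hcov).trans (Set.ncard_union_le _ _)
  nlinarith

end BSTW

/-- Lemma 5.1 (Harvey–Wood): if for every weight function there is a `(w,c)`-balanced
separator of size at most `k`, then `tw(G) ≤ k/(1-c)`. -/
theorem balanced_separators_to_treewidth [Fintype V] (G : SimpleGraph V)
    (c : ℝ) (hc : 1/2 ≤ c ∧ c < 1) (k : ℕ) (hk : 0 < k)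
    (h : ∀ w : V → ℝ, IsWeightFun w →
      ∃ X : Set V, IsBalancedSep G w c X ∧ X.ncard ≤ k) :
    HasTreeDecompOfWidthLE G ((k : ℝ) / (1 - c)) := by
  have hc1 : 0 < 1 - c := by linarith [hc.2]
  obtain ⟨ι, T, τ, r, hT, _, ha⟩ := BSTW.exists_admissible G _
    (BSTW.bramble_order G c hc k h) ∅ ⟨by simp, by simp, by simp⟩
  refine ⟨ι, T, τ, hT.tree, fun v => hT.vert v trivial,
    fun u v huv => hT.edge u trivial v trivial huv, fun v => ?_, fun t => ?_⟩
  · exact BSTW.induce_of_connIn (hT.vert v trivial)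
      (fun t ht t' ht' => hT.conn v t t' ht ht')
  · have h1 := ha t (fun U hU => hU.elim)
    have h2 : ((τ t).ncard : ℝ) ≤ (k : ℝ) / (1 - c) :=
      (Nat.le_floor_iff (by positivity)).1 h1
    linarith
end
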